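/- arXiv:1903.05347 — 6 statements merged into one kernel-verified Lean document; each statement's English description precedes it below -/
import Mathlib

section
/- For every n ≥ 3, the directed cycle C_n on n vertices (with edges u_1 → u_2 → ⋯ → u_n → u_1) does not admit a translational embedding: there is no dimension d, map φ : V → ℝ^d, unit vector z ∈ ℝ^d, and thresholds t_u ≥ 0 (u ∈ V) such that for all vertices u ≠ v, (u,v) ∈ E if and only if ‖φ(v) − (φ(u) + z)‖ ≤ t_u. -/
/-- Summing around a cycle, the squared distances from each translated point to its successor
and to its predecessor agree. -/
lemma sum_sq_norm_translate_succ_eq_pred {E : Type*} [NormedAddCommGroup E]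
    [InnerProductSpace ℝ E] (m : ℕ) (φ : Fin (m + 1) → E) (z : E) :
    ∑ u, ‖φ (u + 1) - (φ u + z)‖ ^ 2 = ∑ u, ‖φ (u - 1) - (φ u + z)‖ ^ 2 := by
  have hpred : ∑ u, ‖φ (u - 1) - (φ u + z)‖ ^ 2 = ∑ u, ‖φ u - (φ (u + 1) + z)‖ ^ 2 := by
    rw [← Equiv.sum_comp (Equiv.addRight (1 : Fin (m + 1)))]
    simp
  have hshift : ∑ u, inner ℝ (φ (u + 1)) z = ∑ u, inner ℝ (φ u) z :=
    Equiv.sum_comp (Equiv.addRight (1 : Fin (m + 1))) fun u => inner ℝ (φ u) z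
  have hdiff (u : Fin (m + 1)) : ‖φ u - (φ (u + 1) + z)‖ ^ 2 =
      ‖φ (u + 1) - (φ u + z)‖ ^ 2 + 4 * (inner ℝ (φ (u + 1)) z - inner ℝ (φ u) z) := by
    have h₁ : φ u - (φ (u + 1) + z) = -((φ (u + 1) - φ u) + z) := by abel
    have h₂ : φ (u + 1) - (φ u + z) = (φ (u + 1) - φ u) - z := by abel
    rw [h₁, h₂, norm_neg, norm_add_sq_real,
      norm_sub_sq_real (φ (u + 1) - φ u) z, inner_sub_left]
    ring
  rw [hpred, Finset.sum_congr rfl fun u _ => hdiff u, Finset.sum_add_distrib, ← Finset.mul_sum,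
    Finset.sum_sub_distrib, hshift]
  ring

/-- For every `n ≥ 3`, the directed cycle `C_n` (edges `u → u+1 mod n`)
does not admit a translational embedding. -/
theorem directed_cycle_no_translational_embedding (n : ℕ) (hn : 3 ≤ n) :
    ¬ ∃ (d : ℕ) (φ : Fin n → EuclideanSpace ℝ (Fin d))
        (z : EuclideanSpace ℝ (Fin d)) (t : Fin n → ℝ),
      ‖z‖ = 1 ∧ (∀ u, 0 ≤ t u) ∧
      ∀ u v : Fin n, u ≠ v →
        ((v.val = (u.val + 1) % n) ↔ ‖φ v - (φ u + z)‖ ≤ t u) := by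
  rintro ⟨d, φ, z, t, -, -, h⟩
  obtain ⟨m, rfl⟩ : ∃ m, n = m + 2 + 1 := ⟨n - 3, by omega⟩
  have hval (u : Fin (m + 2 + 1)) : (u + 1).val = (u.val + 1) % (m + 2 + 1) := by
    simp [Fin.val_add]
  have hone : (1 : Fin (m + 2 + 1)) ≠ 0 := by simp
  have htwo : (1 : Fin (m + 2 + 1)) + 1 ≠ 0 := by
    intro h0
    have := congrArg Fin.val h0
    simp only [hval, Fin.val_one, Fin.val_zero, Nat.mod_eq_of_lt (show 1 + 1 < m + 2 + 1 by omega)] at this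
    omega
  have hlt (u : Fin (m + 2 + 1)) :
      ‖φ (u + 1) - (φ u + z)‖ ^ 2 < ‖φ (u - 1) - (φ u + z)‖ ^ 2 := by
    have hsucc := (h u (u + 1) (by simp)).1 (hval u)
    have hpred : ¬ ‖φ (u - 1) - (φ u + z)‖ ≤ t u := by
      rw [← h u (u - 1) (fun e => hone (sub_eq_self.1 e.symm)), ← hval, ← Fin.ext_iff]
      intro e
      apply htwo
      exact left_eq_add.1 ((sub_eq_iff_eq_add.1 e).trans (add_assoc u 1 1))
    have := hsucc.trans_lt (not_le.1 hpred)
    gcongr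
  exact (Finset.sum_lt_sum_of_nonempty Finset.univ_nonempty fun u _ => hlt u).ne
    (sum_sq_norm_translate_succ_eq_pred (m + 2) φ z)
end

section
/- Every finite directed acyclic graph G admits a uniform translational embedding: there exist a dimension d, a map φ : V → ℝ^d, a unit vector z ∈ ℝ^d, and a single threshold t ≥ 0 such that for all vertices u ≠ v, (u,v) ∈ E if and only if ‖φ(v) − (φ(u) + z)‖ ≤ t. -/
open Finset in
/-- A symmetric real matrix with nonnegative diagonal that is diagonally dominant is positive
semidefinite. -/
theorem Matrix.IsHermitian.posSemidef_of_sum_row_le_diag {n : Type*} [Fintype n] [DecidableEq n]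
    {A : Matrix n n ℝ} (hA : A.IsHermitian) (h : ∀ k, ∑ j ∈ univ.erase k, ‖A k j‖ ≤ A k k) :
    A.PosSemidef := by
  rw [Matrix.posSemidef_iff_isHermitian_and_spectrum_nonneg]
  refine ⟨hA, fun μ hμ ↦ ?_⟩
  rw [← Matrix.spectrum_toLin', ← Module.End.hasEigenvalue_iff_mem_spectrum] at hμ
  obtain ⟨k, hk⟩ := eigenvalue_mem_ball hμ
  rw [mem_closedBall_iff_norm, Real.norm_eq_abs] at hk
  have := (abs_le.1 (hk.trans (h k))).1
  simp only [Set.mem_ofPred_eq]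
  linarith

open Finset in
open scoped MatrixOrder Matrix.Norms.L2Operator in
/-- Any symmetric function becomes, after adding a large constant, the squared distance function
of a finite family of points in a Euclidean space. -/
theorem exists_norm_sub_sq_eq_add {V : Type*} [Fintype V] (D : V → V → ℝ)
    (hD : ∀ u v, D u v = D v u) :
    ∃ (ψ : V → EuclideanSpace ℝ V) (R : ℝ), 0 ≤ R ∧
      ∀ u v, u ≠ v → ‖ψ v - ψ u‖ ^ 2 = R + D u v := by
  classical
  set R : ℝ := ∑ i, ∑ j, |D i j|
  let A : Matrix V V ℝ := .of fun i j ↦ if i = j then R / 2 else -(D i j) / 2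
  have hA : A.IsHermitian := by
    ext i j
    simp [A, hD j i, eq_comm]
  have hrow (k : V) : ∑ j ∈ univ.erase k, ‖A k j‖ ≤ A k k := by
    calc ∑ j ∈ univ.erase k, ‖A k j‖ = ∑ j ∈ univ.erase k, |D k j| / 2 := by
          refine sum_congr rfl fun j hj ↦ ?_
          simp [A, (ne_of_mem_erase hj).symm]
      _ ≤ ∑ j, |D k j| / 2 :=
          sum_le_sum_of_subset_of_nonneg (erase_subset _ _) fun _ _ _ ↦ by positivity
      _ = (∑ j, |D k j|) / 2 := by rw [sum_div]
      _ ≤ R / 2 := by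
          gcongr
          exact single_le_sum (f := fun i ↦ ∑ j, |D i j|)
            (fun i _ ↦ sum_nonneg fun _ _ ↦ abs_nonneg _) (mem_univ k)
      _ = A k k := by simp [A]
  obtain ⟨B, hB⟩ := CStarAlgebra.nonneg_iff_eq_star_mul_self.1
    (hA.posSemidef_of_sum_row_le_diag hrow).nonneg
  have hinner (u v : V) : inner ℝ (WithLp.toLp 2 fun i ↦ B i u : EuclideanSpace ℝ V)
      (WithLp.toLp 2 fun i ↦ B i v) = A u v := by
    simp [hB, Matrix.star_eq_conjTranspose, Matrix.mul_apply, PiLp.inner_apply, mul_comm]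
  refine ⟨fun u ↦ WithLp.toLp 2 fun i ↦ B i u, R, by positivity, fun u v huv ↦ ?_⟩
  rw [← real_inner_self_eq_norm_sq, inner_sub_sub_self]
  simp only [hinner]
  simp [A, huv, huv.symm, hD v u]
  ring

open Finset in
/-- A finite acyclic relation has a real-valued height function. -/
theorem exists_height_of_acyclic {V : Type*} [Fintype V] (E : V → V → Prop)
    (hE : ∀ v : V, ¬ Relation.TransGen E v v) :
    ∃ h : V → ℝ, ∀ u v, E u v → h u < h v := by
  classical
  refine ⟨fun v ↦ #{w | Relation.TransGen E w v}, fun u v huv ↦ ?_⟩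
  refine Nat.cast_lt.2 (card_lt_card (ssubset_iff_of_subset ?_ |>.2 ⟨u, ?_, ?_⟩))
  · intro w hw
    simp only [mem_filter, mem_univ, true_and] at hw ⊢
    exact hw.tail huv
  · simpa using .single huv
  · simpa using hE u

/-- Every finite directed acyclic graph admits a uniform translational
embedding. -/
theorem dag_uniform_translational_embedding {V : Type*} [Fintype V]
    (E : V → V → Prop) (hacyclic : ∀ v : V, ¬ Relation.TransGen E v v) :
    ∃ (d : ℕ) (φ : V → EuclideanSpace ℝ (Fin d))
      (z : EuclideanSpace ℝ (Fin d)) (t : ℝ),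
      ‖z‖ = 1 ∧ 0 ≤ t ∧
      ∀ u v : V, u ≠ v → (E u v ↔ ‖φ v - (φ u + z)‖ ≤ t) := by
  classical
  obtain ⟨h, hh⟩ := exists_height_of_acyclic E hacyclic
  obtain ⟨ψ, R, hR, hψ⟩ := exists_norm_sub_sq_eq_add
    (fun u v ↦ 2 * |h v - h u| - (h v - h u) ^ 2 + if E u v ∨ E v u then 0 else 1)
    (fun u v ↦ by
      simp only [abs_sub_comm (h v), or_comm (a := E u v)]
      ring)
  let b := (stdOrthonormalBasis ℝ (WithLp 2 (ℝ × EuclideanSpace ℝ V))).repr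
  refine ⟨_, fun u ↦ b (WithLp.toLp 2 (h u, ψ u)), b (WithLp.toLp 2 (1, 0)), √(1 + R),
    ?_, by positivity, fun u v huv ↦ ?_⟩
  · rw [b.norm_map, ← sq_eq_sq₀ (norm_nonneg _) zero_le_one, WithLp.prod_norm_sq_eq_of_L2]
    simp
  rw [← map_add, ← map_sub, b.norm_map, Real.le_sqrt (norm_nonneg _) (by positivity),
    WithLp.prod_norm_sq_eq_of_L2]
  simp only [WithLp.sub_fst, WithLp.add_fst, WithLp.sub_snd, WithLp.add_snd, WithLp.toLp_fst,
    WithLp.toLp_snd, add_zero, hψ u v huv, Real.norm_eq_abs, sq_abs]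
  by_cases huv' : E u v
  · simp only [huv', true_or, if_true, true_iff, abs_of_pos (sub_pos.2 (hh u v huv'))]
    linarith
  · simp only [huv', false_or, false_iff, not_le]
    split_ifs with hvu
    · nlinarith [abs_nonneg (h v - h u), hh v u hvu]
    · nlinarith [le_abs_self (h v - h u)]
end

section
/- For every finite directed graph G, d_dist(G) ≤ d°_dist(G) ≤ d_dist(G) + 1. In particular, if G has a distance embedding into ℝ^d, then G has a distance embedding into the unit sphere of ℝ^{d+1}. -/
/-- A distance embedding of the directed graph with edge relation `E` into `ℝ^d`. -/
def IsDistanceEmbedding {V : Type*} {d : ℕ} (E : V → V → Prop)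
    (φin φout : V → EuclideanSpace ℝ (Fin d)) (t : ℝ) : Prop :=
  0 ≤ t ∧ ∀ u v : V, E u v ↔ ‖φout u - φin v‖ ≤ t

/-- `d_dist(G)`: the smallest dimension of a distance embedding of `G`. -/
noncomputable def ddist {V : Type*} (E : V → V → Prop) : ℕ :=
  sInf {d : ℕ | ∃ (φin φout : V → EuclideanSpace ℝ (Fin d)) (t : ℝ),
    IsDistanceEmbedding E φin φout t}

/-- `d°_dist(G)`: the smallest dimension of a distance embedding of `G` into the unit
sphere. -/
noncomputable def ddistSphere {V : Type*} (E : V → V → Prop) : ℕ :=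
  sInf {d : ℕ | ∃ (φin φout : V → EuclideanSpace ℝ (Fin d)) (t : ℝ),
    IsDistanceEmbedding E φin φout t ∧ (∀ u, ‖φin u‖ = 1) ∧ (∀ u, ‖φout u‖ = 1)}

theorem EuclideanSpace.norm_sq_toLp_cons {d : ℕ} (c : ℝ) (x : EuclideanSpace ℝ (Fin d)) :
    ‖(WithLp.toLp 2 (Fin.cons c x : Fin (d + 1) → ℝ) : EuclideanSpace ℝ (Fin (d + 1)))‖ ^ 2
      = c ^ 2 + ‖x‖ ^ 2 := by
  simp [EuclideanSpace.norm_sq_eq, Fin.sum_univ_succ]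

/-- The inverse stereographic projection of `ε • x` onto the unit sphere. -/
noncomputable def sphereLift {d : ℕ} (ε : ℝ) (x : EuclideanSpace ℝ (Fin d)) :
    EuclideanSpace ℝ (Fin (d + 1)) :=
  WithLp.toLp 2 (Fin.cons ((1 - ε ^ 2 * ‖x‖ ^ 2) / (1 + ε ^ 2 * ‖x‖ ^ 2))
    ((2 * ε / (1 + ε ^ 2 * ‖x‖ ^ 2)) • x : EuclideanSpace ℝ (Fin d)))

theorem norm_sphereLift {d : ℕ} (ε : ℝ) (x : EuclideanSpace ℝ (Fin d)) :
    ‖sphereLift ε x‖ = 1 := by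
  have h : 1 + ε ^ 2 * ‖x‖ ^ 2 ≠ 0 := by positivity
  rw [← sq_eq_sq₀ (norm_nonneg _) zero_le_one, sphereLift, EuclideanSpace.norm_sq_toLp_cons,
    norm_smul, mul_pow, Real.norm_eq_abs, sq_abs]
  field_simp
  ring

theorem norm_sphereLift_sub_sq {d : ℕ} (ε : ℝ) (x y : EuclideanSpace ℝ (Fin d)) :
    ‖sphereLift ε x - sphereLift ε y‖ ^ 2 = (2 * ε) ^ 2 *
      (‖x - y‖ ^ 2 / ((1 + ε ^ 2 * ‖x‖ ^ 2) * (1 + ε ^ 2 * ‖y‖ ^ 2))) := by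
  have hx : 1 + ε ^ 2 * ‖x‖ ^ 2 ≠ 0 := by positivity
  have hy : 1 + ε ^ 2 * ‖y‖ ^ 2 ≠ 0 := by positivity
  have hsub : sphereLift ε x - sphereLift ε y = WithLp.toLp 2 (Fin.cons
      ((1 - ε ^ 2 * ‖x‖ ^ 2) / (1 + ε ^ 2 * ‖x‖ ^ 2) -
        (1 - ε ^ 2 * ‖y‖ ^ 2) / (1 + ε ^ 2 * ‖y‖ ^ 2))
      ((2 * ε / (1 + ε ^ 2 * ‖x‖ ^ 2)) • x - (2 * ε / (1 + ε ^ 2 * ‖y‖ ^ 2)) • y :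
        EuclideanSpace ℝ (Fin d))) := by
    ext i
    refine Fin.cases ?_ (fun j => ?_) i <;> simp [sphereLift]
  rw [hsub, EuclideanSpace.norm_sq_toLp_cons, norm_sub_sq_real, norm_sub_sq_real, norm_smul,
    norm_smul, inner_smul_left, inner_smul_right, mul_pow, mul_pow, Real.norm_eq_abs,
    Real.norm_eq_abs, sq_abs, sq_abs]
  simp only [conj_trivial]
  field_simp
  ring

/-- On a finite graph the threshold can be moved off all the realized distances. -/
theorem IsDistanceEmbedding.exists_strict {V : Type*} [Finite V] {d : ℕ} {E : V → V → Prop}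
    {φin φout : V → EuclideanSpace ℝ (Fin d)} {t : ℝ} (h : IsDistanceEmbedding E φin φout t) :
    ∃ r : ℝ, 0 < r ∧ ∀ u v : V, (E u v → ‖φout u - φin v‖ < r) ∧
      (¬ E u v → r < ‖φout u - φin v‖) := by
  have key : ∀ᶠ r in nhdsWithin t (Set.Ioi t), ∀ u v : V, ¬ E u v → r < ‖φout u - φin v‖ := by
    simp only [Filter.eventually_all]
    intro u v huv
    have hlt : t < ‖φout u - φin v‖ := not_le.mp fun hle => huv ((h.2 u v).mpr hle)
    exact nhdsWithin_le_nhds (eventually_lt_nhds hlt)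
  obtain ⟨r, hr, htr⟩ := (key.and self_mem_nhdsWithin).exists
  exact ⟨r, h.1.trans_lt htr, fun u v => ⟨fun huv => ((h.2 u v).mp huv).trans_lt htr, hr u v⟩⟩

/-- A distance embedding into `ℝ^d` yields one into the unit sphere of `ℝ^{d+1}`. -/
theorem IsDistanceEmbedding.exists_sphere {V : Type*} [Finite V] {d : ℕ} {E : V → V → Prop}
    {φin φout : V → EuclideanSpace ℝ (Fin d)} {t : ℝ} (h : IsDistanceEmbedding E φin φout t) :
    ∃ (ψin ψout : V → EuclideanSpace ℝ (Fin (d + 1))) (s : ℝ),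
      IsDistanceEmbedding E ψin ψout s ∧ (∀ u, ‖ψin u‖ = 1) ∧ (∀ u, ‖ψout u‖ = 1) := by
  obtain ⟨r, hr, hstrict⟩ := h.exists_strict
  let f : V → V → ℝ → ℝ := fun u v ε => ‖φout u - φin v‖ ^ 2 /
    ((1 + ε ^ 2 * ‖φout u‖ ^ 2) * (1 + ε ^ 2 * ‖φin v‖ ^ 2))
  have hf : ∀ u v, Filter.Tendsto (f u v) (nhdsWithin 0 (Set.Ioi 0))
      (nhds (‖φout u - φin v‖ ^ 2)) := by
    intro u v
    have hc : Continuous (f u v) := by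
      refine Continuous.div (by fun_prop) (by fun_prop) fun ε => ?_
      positivity
    have h0 : f u v 0 = ‖φout u - φin v‖ ^ 2 := by simp [f]
    exact h0 ▸ (hc.tendsto 0).mono_left nhdsWithin_le_nhds
  have key : ∀ᶠ ε in nhdsWithin (0 : ℝ) (Set.Ioi 0), ∀ u v : V, E u v ↔ f u v ε ≤ r ^ 2 := by
    simp only [Filter.eventually_all]
    intro u v
    by_cases huv : E u v
    · have hlt : ‖φout u - φin v‖ ^ 2 < r ^ 2 :=
        pow_lt_pow_left₀ ((hstrict u v).1 huv) (norm_nonneg _) two_ne_zero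
      filter_upwards [(hf u v).eventually_lt_const hlt] with ε hε
      exact iff_of_true huv hε.le
    · have hlt : r ^ 2 < ‖φout u - φin v‖ ^ 2 :=
        pow_lt_pow_left₀ ((hstrict u v).2 huv) hr.le two_ne_zero
      filter_upwards [(hf u v).eventually_const_lt hlt] with ε hε
      exact iff_of_false huv hε.not_ge
  obtain ⟨ε, hE, hε⟩ := (key.and self_mem_nhdsWithin).exists
  replace hε : 0 < ε := hε
  refine ⟨fun v => sphereLift ε (φin v), fun u => sphereLift ε (φout u), 2 * ε * r,
    ⟨by positivity, fun u v => ?_⟩, fun _ => norm_sphereLift _ _, fun _ => norm_sphereLift _ _⟩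
  rw [hE u v, ← sq_le_sq₀ (norm_nonneg _) (by positivity : 0 ≤ 2 * ε * r),
    norm_sphereLift_sub_sq, mul_pow _ r, mul_le_mul_iff_right₀ (by positivity)]

/-- Every finite directed graph has a distance embedding: send the in-vertices to the standard
basis and the out-vertices to the sign vectors of their neighbourhoods. -/
theorem exists_isDistanceEmbedding {V : Type*} [Fintype V] (E : V → V → Prop) :
    ∃ (d : ℕ) (φin φout : V → EuclideanSpace ℝ (Fin d)) (t : ℝ),
      IsDistanceEmbedding E φin φout t := by
  classical
  let e := Fintype.equivFin V
  let σ : V → V → ℝ := fun u v => if E u v then 1 else -1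
  have hσ : ∀ u v, σ u v ^ 2 = 1 := fun u v => by
    by_cases huv : E u v <;> simp [σ, huv]
  refine ⟨Fintype.card V, fun v => EuclideanSpace.single (e v) 1,
    fun u => WithLp.toLp 2 fun i => σ u (e.symm i), √(Fintype.card V), Real.sqrt_nonneg _,
    fun u v => ?_⟩
  have hdist : ‖(WithLp.toLp 2 fun i => σ u (e.symm i) : EuclideanSpace ℝ (Fin (Fintype.card V)))
      - EuclideanSpace.single (e v) 1‖ ^ 2 = Fintype.card V - 2 * σ u v + 1 := by
    rw [norm_sub_sq_real, EuclideanSpace.inner_single_right, EuclideanSpace.norm_sq_eq]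
    simp [hσ]
  rw [Real.le_sqrt (norm_nonneg _) (Nat.cast_nonneg _), hdist]
  by_cases huv : E u v
  · refine iff_of_true huv ?_
    simp only [σ, if_pos huv]
    linarith
  · refine iff_of_false huv ?_
    simp only [σ, if_neg huv]
    linarith

/-- `d_dist(G) ≤ d°_dist(G) ≤ d_dist(G) + 1`; in particular a distance
embedding into `ℝ^d` yields a distance embedding into the unit sphere of `ℝ^{d+1}`. -/
theorem ddist_le_ddistSphere_le_ddist_add_one {V : Type*} [Fintype V] (E : V → V → Prop) :
    (ddist E ≤ ddistSphere E ∧ ddistSphere E ≤ ddist E + 1) ∧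
    ∀ (d : ℕ) (φin φout : V → EuclideanSpace ℝ (Fin d)) (t : ℝ),
      IsDistanceEmbedding E φin φout t →
      ∃ (ψin ψout : V → EuclideanSpace ℝ (Fin (d + 1))) (s : ℝ),
        IsDistanceEmbedding E ψin ψout s ∧
        (∀ u, ‖ψin u‖ = 1) ∧ (∀ u, ‖ψout u‖ = 1) := by
  refine ⟨⟨?_, ?_⟩, fun d φin φout t h => h.exists_sphere⟩
  · obtain ⟨d, φin, φout, t, h⟩ := exists_isDistanceEmbedding E
    obtain ⟨ψin, ψout, s, hs, -⟩ := Nat.sInf_mem (s := {d : ℕ |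
      ∃ (φin φout : V → EuclideanSpace ℝ (Fin d)) (t : ℝ), IsDistanceEmbedding E φin φout t ∧
        (∀ u, ‖φin u‖ = 1) ∧ (∀ u, ‖φout u‖ = 1)}) ⟨d + 1, h.exists_sphere⟩
    exact Nat.sInf_le ⟨ψin, ψout, s, hs⟩
  · obtain ⟨φin, φout, t, h⟩ := Nat.sInf_mem (s := {d : ℕ |
      ∃ (φin φout : V → EuclideanSpace ℝ (Fin d)) (t : ℝ), IsDistanceEmbedding E φin φout t})
      (exists_isDistanceEmbedding E)
    exact Nat.sInf_le h.exists_sphere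
end

section
/- Let G = (V,E) be a finite directed graph with at least one edge in which every vertex has indegree at most Δ₋ and outdegree at most Δ₊. Then G has a distance embedding that is √(1/(Δ₊Δ₋))-robust. -/
open scoped Matrix in
/-- Every real positive semidefinite matrix is the Gram matrix of a family of Euclidean vectors. -/
theorem Matrix.PosSemidef.exists_inner_eq {ι : Type*} [Fintype ι] {M : Matrix ι ι ℝ}
    (hM : M.PosSemidef) :
    ∃ (d : ℕ) (f : ι → EuclideanSpace ℝ (Fin d)), ∀ i j, inner ℝ (f i) (f j) = M i j := by
  classical
  obtain ⟨B, rfl⟩ : ∃ B : Matrix ι ι ℝ, M = Bᴴ * B := by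
    open scoped MatrixOrder in
    exact CStarAlgebra.nonneg_iff_eq_star_mul_self.mp hM.nonneg
  let e := Fintype.equivFin ι
  refine ⟨Fintype.card ι, fun i => WithLp.toLp 2 fun k => B (e.symm k) i, fun i j => ?_⟩
  simp only [PiLp.inner_apply, Matrix.mul_apply, Matrix.conjTranspose_apply]
  rw [← Equiv.sum_comp e.symm]
  exact Finset.sum_congr rfl fun k _ => by simp [mul_comm]

/-- The Schur bound for a relation with bounded degrees, in quadratic form. -/
theorem two_mul_abs_sum_rel_le {V : Type*} [Fintype V] (E : V → V → Prop) [DecidableRel E]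
    {p m : ℝ} (hp : 0 < p) (hm : 0 < m)
    (hout : ∀ u, ((Finset.univ.filter fun v => E u v).card : ℝ) ≤ p)
    (hin : ∀ v, ((Finset.univ.filter fun u => E u v).card : ℝ) ≤ m) (x y : V → ℝ) :
    2 * |∑ u, ∑ v, if E u v then x u * y v else 0| ≤
      √(p * m) * (∑ u, x u ^ 2 + ∑ v, y v ^ 2) := by
  set a := √p
  set b := √m
  have ha : 0 < a := Real.sqrt_pos.mpr hp
  have hb : 0 < b := Real.sqrt_pos.mpr hm
  have hpa : p = a ^ 2 := (Real.sq_sqrt hp.le).symm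
  have hmb : m = b ^ 2 := (Real.sq_sqrt hm.le).symm
  have hx : ∑ u, ∑ v, (if E u v then b / a * x u ^ 2 else 0) ≤ a * b * ∑ u, x u ^ 2 := by
    rw [Finset.mul_sum]
    refine Finset.sum_le_sum fun u _ => ?_
    rw [← Finset.sum_filter, Finset.sum_const, nsmul_eq_mul]
    calc _ ≤ p * (b / a * x u ^ 2) := by gcongr; exact hout u
      _ = a * b * x u ^ 2 := by rw [hpa]; field_simp
  have hy : ∑ u, ∑ v, (if E u v then a / b * y v ^ 2 else 0) ≤ a * b * ∑ v, y v ^ 2 := by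
    rw [Finset.sum_comm, Finset.mul_sum]
    refine Finset.sum_le_sum fun v _ => ?_
    rw [← Finset.sum_filter, Finset.sum_const, nsmul_eq_mul]
    calc _ ≤ m * (a / b * y v ^ 2) := by gcongr; exact hin v
      _ = a * b * y v ^ 2 := by rw [hmb]; field_simp
  have hxy : 2 * |∑ u, ∑ v, if E u v then x u * y v else 0| ≤
      ∑ u, ∑ v, (if E u v then b / a * x u ^ 2 else 0) +
        ∑ u, ∑ v, (if E u v then a / b * y v ^ 2 else 0) := by
    simp only [← Finset.sum_add_distrib]
    calc _ ≤ 2 * ∑ u, ∑ v, |if E u v then x u * y v else 0| := by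
          gcongr
          exact (Finset.abs_sum_le_sum_abs _ _).trans
            (Finset.sum_le_sum fun u _ => Finset.abs_sum_le_sum_abs _ _)
      _ ≤ _ := by
          simp only [Finset.mul_sum]
          refine Finset.sum_le_sum fun u _ => Finset.sum_le_sum fun v _ => ?_
          split_ifs
          · have h : b / a * x u ^ 2 + a / b * y v ^ 2 - 2 * (|x u| * |y v|) =
                (b * |x u| - a * |y v|) ^ 2 / (a * b) := by
              rw [← sq_abs (x u), ← sq_abs (y v)]
              field_simp
              ring
            have : 0 ≤ (b * |x u| - a * |y v|) ^ 2 / (a * b) := by positivity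
            rw [abs_mul]
            linarith
          · simp
  rw [Real.sqrt_mul hp.le, mul_add]
  linarith

/-- If all outdegrees are at most `p` and all indegrees at most `m`, there are two families of unit
vectors whose cross inner products are the adjacency matrix scaled by `(√(p * m))⁻¹`. -/
theorem exists_unit_vectors_inner_eq_of_degree_bounds {V : Type*} [Fintype V]
    (E : V → V → Prop) [DecidableRel E] {p m : ℝ} (hp : 0 < p) (hm : 0 < m)
    (hout : ∀ u, ((Finset.univ.filter fun v => E u v).card : ℝ) ≤ p)
    (hin : ∀ v, ((Finset.univ.filter fun u => E u v).card : ℝ) ≤ m) :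
    ∃ (d : ℕ) (f g : V → EuclideanSpace ℝ (Fin d)), (∀ u, ‖f u‖ = 1) ∧ (∀ v, ‖g v‖ = 1) ∧
      ∀ u v, inner ℝ (f u) (g v) = if E u v then (√(p * m))⁻¹ else 0 := by
  classical
  have hc : 0 < √(p * m) := Real.sqrt_pos.mpr (mul_pos hp hm)
  let A : Matrix V V ℝ := Matrix.of fun u v => if E u v then (√(p * m))⁻¹ else 0
  have hM : (Matrix.fromBlocks 1 A A.transpose 1).PosSemidef := by
    refine Matrix.PosSemidef.of_dotProduct_mulVec_nonneg ?_ fun z => ?_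
    · simp [Matrix.IsHermitian, Matrix.fromBlocks_transpose,
        Matrix.conjTranspose_eq_transpose_of_trivial]
    · obtain ⟨x, y, rfl⟩ : ∃ x y : V → ℝ, z = Sum.elim x y :=
        ⟨z ∘ Sum.inl, z ∘ Sum.inr, (Sum.elim_comp_inl_inr z).symm⟩
      have hA : x ⬝ᵥ A.mulVec y =
          (√(p * m))⁻¹ * ∑ u, ∑ v, if E u v then x u * y v else 0 := by
        simp only [dotProduct, Matrix.mulVec, A, Matrix.of_apply, Finset.mul_sum]
        refine Finset.sum_congr rfl fun u _ => Finset.sum_congr rfl fun v _ => ?_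
        split_ifs <;> ring
      have hAT : y ⬝ᵥ A.transpose.mulVec x = x ⬝ᵥ A.mulVec y := by
        rw [Matrix.mulVec_transpose, dotProduct_comm, Matrix.dotProduct_mulVec]
      have hsq (w : V → ℝ) : w ⬝ᵥ w = ∑ u, w u ^ 2 := by simp [dotProduct, sq]
      have h := two_mul_abs_sum_rel_le E hp hm hout hin x y
      have hneg := neg_abs_le (∑ u, ∑ v, if E u v then x u * y v else 0)
      set S := ∑ u, ∑ v, if E u v then x u * y v else 0
      have key : 0 ≤ (√(p * m))⁻¹ *
          (√(p * m) * (∑ u, x u ^ 2 + ∑ v, y v ^ 2) + 2 * S) :=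
        mul_nonneg (by positivity) (by linarith)
      rw [mul_add, inv_mul_cancel_left₀ hc.ne'] at key
      rw [star_trivial, Matrix.fromBlocks_mulVec, sumElim_dotProduct_sumElim]
      simp only [Sum.elim_comp_inl, Sum.elim_comp_inr, Matrix.one_mulVec, dotProduct_add,
        hAT, hA, hsq]
      linarith
  obtain ⟨d, f, hf⟩ := hM.exists_inner_eq
  have hnorm (i : V ⊕ V) : ‖f i‖ = 1 := by
    have h := hf i i
    rw [real_inner_self_eq_norm_sq] at h
    exact (pow_eq_one_iff_of_nonneg (norm_nonneg _) two_ne_zero).mp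
      (h.trans (by cases i <;> simp))
  exact ⟨d, f ∘ Sum.inl, f ∘ Sum.inr, fun u => hnorm _, fun v => hnorm _,
    fun u v => by simpa [A] using hf (Sum.inl u) (Sum.inr v)⟩

/-- a finite directed graph with at least one edge, indegrees at most `Δ₋`
and outdegrees at most `Δ₊`, has a `√(1/(Δ₊Δ₋))`-robust distance embedding. -/
theorem exists_robust_distance_embedding_of_degree_bounds {V : Type*} [Fintype V]
    (E : V → V → Prop) [DecidableRel E] (Δplus Δminus : ℕ) (hE : ∃ u v, E u v)
    (hout : ∀ u : V, (Finset.univ.filter fun v => E u v).card ≤ Δplus)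
    (hin : ∀ u : V, (Finset.univ.filter fun v => E v u).card ≤ Δminus) :
    ∃ (d : ℕ) (φin φout : V → EuclideanSpace ℝ (Fin d)) (t : ℝ),
      0 ≤ t ∧
      (∀ u v, E u v ↔ ‖φout u - φin v‖ ≤ t) ∧
      (∀ u v, E u v → ‖φout u - φin v‖ ^ 2 ≤ t ^ 2) ∧
      (∀ u v, ¬ E u v →
        t ^ 2 * (1 + Real.sqrt (1 / ((Δplus : ℝ) * (Δminus : ℝ)))) ≤ ‖φout u - φin v‖ ^ 2) := by
  obtain ⟨u₀, v₀, h₀⟩ := hE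
  have hp : 1 ≤ Δplus := (Finset.card_pos.mpr ⟨v₀, by simpa using h₀⟩).trans_le (hout u₀)
  have hm : 1 ≤ Δminus := (Finset.card_pos.mpr ⟨u₀, by simpa using h₀⟩).trans_le (hin v₀)
  have hp' : (1 : ℝ) ≤ Δplus := by exact_mod_cast hp
  have hm' : (1 : ℝ) ≤ Δminus := by exact_mod_cast hm
  obtain ⟨d, f, g, hf, hg, hfg⟩ := exists_unit_vectors_inner_eq_of_degree_bounds E
    (zero_lt_one.trans_le hp') (zero_lt_one.trans_le hm')
    (fun u => by exact_mod_cast hout u) (fun v => by exact_mod_cast hin v)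
  have hc : 1 ≤ √((Δplus : ℝ) * Δminus) :=
    Real.one_le_sqrt.mpr (one_le_mul_of_one_le_of_one_le hp' hm')
  rw [one_div, Real.sqrt_inv]
  set r := (√((Δplus : ℝ) * Δminus))⁻¹
  have hr : 0 < r := inv_pos.mpr (zero_lt_one.trans_le hc)
  have hr1 : r ≤ 1 := inv_le_one_of_one_le₀ hc
  have ht : √(2 - 2 * r) ^ 2 = 2 - 2 * r := Real.sq_sqrt (by linarith)
  have hdist (u v : V) : ‖f u - g v‖ ^ 2 = if E u v then 2 - 2 * r else 2 := by
    rw [norm_sub_sq_real, hf, hg, hfg]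
    split_ifs <;> ring
  refine ⟨d, g, f, √(2 - 2 * r), Real.sqrt_nonneg _, fun u v => ?_, fun u v h => ?_,
    fun u v h => ?_⟩
  · rw [← sq_le_sq₀ (norm_nonneg _) (Real.sqrt_nonneg _), ht, hdist]
    split_ifs with h
    · simp [h]
    · simp [h, hr]
  · rw [ht, hdist, if_pos h]
  · rw [ht, hdist, if_neg h]
    nlinarith [sq_nonneg r]
end

section
/- There is a universal constant C > 0 such that the following holds: if a finite directed graph G on n ≥ 2 vertices has a δ-robust distance embedding (into ℝ^d for some d) with 0 < δ ≤ 1, then G also has a (δ/2)-robust distance embedding into ℝ^m with m ≤ ⌈C·(log n)/δ²⌉. -/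
section GaussianSquare

open MeasureTheory ProbabilityTheory

lemma gaussianPDFReal_zero_one_mul_exp_sq (c x : ℝ) :
    gaussianPDFReal 0 1 x * Real.exp (c * x ^ 2) =
      (√(2 * Real.pi))⁻¹ * Real.exp (-(1 / 2 - c) * x ^ 2) := by
  rw [gaussianPDFReal_def, mul_assoc, ← Real.exp_add]
  simp only [NNReal.coe_one, mul_one, sub_zero]
  congr 2
  ring

lemma integrable_exp_mul_sq_gaussianReal {c : ℝ} (hc : c < 1 / 2) :
    Integrable (fun x : ℝ ↦ Real.exp (c * x ^ 2)) (gaussianReal 0 1) := by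
  rw [gaussianReal_of_var_ne_zero 0 one_ne_zero,
    integrable_withDensity_iff_integrable_smul' (measurable_gaussianPDF 0 1)
      (ae_of_all _ fun _ ↦ gaussianPDF_lt_top)]
  simp_rw [toReal_gaussianPDF, smul_eq_mul, gaussianPDFReal_zero_one_mul_exp_sq]
  exact (integrable_exp_neg_mul_sq (by linarith)).const_mul _

lemma integral_exp_mul_sq_gaussianReal {c : ℝ} (hc : c < 1 / 2) :
    ∫ x, Real.exp (c * x ^ 2) ∂(gaussianReal 0 1) = √(1 / (1 - 2 * c)) := by
  rw [integral_gaussianReal_eq_integral_smul one_ne_zero]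
  simp_rw [smul_eq_mul, gaussianPDFReal_zero_one_mul_exp_sq]
  have hpi := Real.pi_pos
  rw [integral_const_mul, integral_gaussian, ← Real.sqrt_inv, ← Real.sqrt_mul (by positivity)]
  have : 1 / 2 - c ≠ 0 := by linarith
  have : 1 - 2 * c ≠ 0 := by linarith
  congr 1
  field_simp

lemma integral_exp_mul_sq_gaussianReal_le {c : ℝ} (hc : |c| ≤ 1 / 4) :
    ∫ x, Real.exp (c * x ^ 2) ∂(gaussianReal 0 1) ≤ Real.exp (c + 4 * c ^ 2) := by
  have hc' := abs_le.1 hc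
  rw [integral_exp_mul_sq_gaussianReal (by linarith)]
  have habs : |2 * c| = 2 * |c| := by rw [abs_mul, abs_two]
  have hpos : 0 < 1 - 2 * c := by linarith
  have hlog : -(2 * c) - 8 * c ^ 2 ≤ Real.log (1 - 2 * c) := by
    have h := Real.abs_log_sub_add_sum_range_le (x := 2 * c) (by rw [habs]; linarith) 1
    have hq : |2 * c| ^ 2 / (1 - |2 * c|) ≤ 8 * c ^ 2 := by
      rw [habs, div_le_iff₀ (by linarith), mul_pow, sq_abs]
      nlinarith [sq_nonneg c]
    norm_num at h hq
    have := (abs_le.1 (h.trans hq)).1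
    linarith
  rw [Real.sqrt_le_left (Real.exp_pos _).le, ← Real.exp_nat_mul, one_div,
    ← Real.exp_log hpos, ← Real.exp_neg]
  apply Real.exp_le_exp.2
  push_cast
  linarith

variable {E : Type*} [NormedAddCommGroup E] [InnerProductSpace ℝ E] [FiniteDimensional ℝ E]
  [MeasurableSpace E] [BorelSpace E]

lemma map_inner_stdGaussian {x : E} (hx : ‖x‖ = 1) :
    (stdGaussian E).map (fun g ↦ inner ℝ x g) = gaussianReal 0 1 := by
  have h := IsGaussian.map_eq_gaussianReal (μ := stdGaussian E) (innerSL ℝ x)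
  rw [integral_strongDual_stdGaussian, variance_dual_stdGaussian, innerSL_apply_norm, hx] at h
  simpa using h

lemma integrable_exp_mul_inner_sq {x : E} (hx : ‖x‖ = 1) {c : ℝ} (hc : |c| ≤ 1 / 4) :
    Integrable (fun g ↦ Real.exp (c * inner ℝ x g ^ 2)) (stdGaussian E) := by
  have h := integrable_exp_mul_sq_gaussianReal (c := c) (by linarith [(abs_le.1 hc).2])
  rw [← map_inner_stdGaussian hx] at h
  exact h.comp_aemeasurable (by fun_prop)

lemma integral_exp_mul_inner_sq_le {x : E} (hx : ‖x‖ = 1) {c : ℝ} (hc : |c| ≤ 1 / 4) :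
    ∫ g, Real.exp (c * inner ℝ x g ^ 2) ∂(stdGaussian E) ≤ Real.exp (c + 4 * c ^ 2) := by
  have h := integral_exp_mul_sq_gaussianReal_le hc
  rwa [← map_inner_stdGaussian hx, integral_map (by fun_prop) (by fun_prop)] at h

lemma integrable_exp_mul_sum_inner_sq {x : E} (hx : ‖x‖ = 1) {c : ℝ} (hc : |c| ≤ 1 / 4) (m : ℕ) :
    Integrable (fun g : Fin m → E ↦ Real.exp (c * ∑ i, inner ℝ x (g i) ^ 2))
      (Measure.pi fun _ ↦ stdGaussian E) := by
  simp_rw [Finset.mul_sum, Real.exp_sum]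
  exact Integrable.fintype_prod fun _ ↦ integrable_exp_mul_inner_sq hx hc

lemma integral_exp_mul_sum_inner_sq_le {x : E} (hx : ‖x‖ = 1) {c : ℝ} (hc : |c| ≤ 1 / 4)
    (m : ℕ) :
    ∫ g : Fin m → E, Real.exp (c * ∑ i, inner ℝ x (g i) ^ 2) ∂(Measure.pi fun _ ↦ stdGaussian E) ≤
      Real.exp (m * (c + 4 * c ^ 2)) := by
  simp_rw [Finset.mul_sum, Real.exp_sum]
  rw [integral_fintype_prod_eq_pow (fun g : E ↦ Real.exp (c * inner ℝ x g ^ 2)),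
    Fintype.card_fin, Real.exp_nat_mul]
  exact pow_le_pow_left₀ (integral_nonneg fun _ ↦ (Real.exp_pos _).le)
    (integral_exp_mul_inner_sq_le hx hc) m

/-- For finitely many unit vectors, there are `m` vectors whose squared inner products with each
of them have a sum close to `m`. -/
lemma exists_sum_inner_sq_near {ι : Type*} [Fintype ι] (x : ι → E) (hx : ∀ k, ‖x k‖ = 1)
    {ε : ℝ} (hε : 0 < ε) (hε1 : ε ≤ 1) (m : ℕ)
    (hm : 2 * Fintype.card ι * Real.exp (-(m * ε ^ 2 / 16)) < 1) :
    ∃ g : Fin m → E, ∀ k, (1 - ε) * m ≤ ∑ i, inner ℝ (x k) (g i) ^ 2 ∧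
      ∑ i, inner ℝ (x k) (g i) ^ 2 ≤ (1 + ε) * m := by
  set μ : Measure (Fin m → E) := Measure.pi fun _ ↦ stdGaussian E
  let S : ι → (Fin m → E) → ℝ := fun k g ↦ ∑ i, inner ℝ (x k) (g i) ^ 2
  have h1 : |ε / 8| ≤ 1 / 4 := by rw [abs_of_pos (by linarith)]; linarith
  have h2 : |-(ε / 8)| ≤ 1 / 4 := by rwa [abs_neg]
  let F : ι → (Fin m → E) → ℝ := fun k g ↦
    Real.exp (-(ε / 8 * ((1 + ε) * m))) * Real.exp (ε / 8 * S k g) +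
      Real.exp (ε / 8 * ((1 - ε) * m)) * Real.exp (-(ε / 8) * S k g)
  have i1 : ∀ k, Integrable
      (fun g ↦ Real.exp (-(ε / 8 * ((1 + ε) * m))) * Real.exp (ε / 8 * S k g)) μ :=
    fun k ↦ (integrable_exp_mul_sum_inner_sq (hx k) h1 m).const_mul _
  have i2 : ∀ k, Integrable
      (fun g ↦ Real.exp (ε / 8 * ((1 - ε) * m)) * Real.exp (-(ε / 8) * S k g)) μ :=
    fun k ↦ (integrable_exp_mul_sum_inner_sq (hx k) h2 m).const_mul _
  have hF : ∀ k, Integrable (F k) μ := fun k ↦ (i1 k).add (i2 k)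
  have hFint : ∀ k, ∫ g, F k g ∂μ ≤ 2 * Real.exp (-(m * ε ^ 2 / 16)) := by
    intro k
    have e1 := mul_le_mul_of_nonneg_left (integral_exp_mul_sum_inner_sq_le (hx k) h1 m)
      (Real.exp_pos (-(ε / 8 * ((1 + ε) * m)))).le
    have e2 := mul_le_mul_of_nonneg_left (integral_exp_mul_sum_inner_sq_le (hx k) h2 m)
      (Real.exp_pos (ε / 8 * ((1 - ε) * m))).le
    rw [← Real.exp_add, ← integral_const_mul] at e1 e2
    have s1 : -(ε / 8 * ((1 + ε) * m)) + m * (ε / 8 + 4 * (ε / 8) ^ 2) = -(m * ε ^ 2 / 16) := by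
      ring
    have s2 : ε / 8 * ((1 - ε) * m) + m * (-(ε / 8) + 4 * (-(ε / 8)) ^ 2)
        = -(m * ε ^ 2 / 16) := by
      ring
    rw [s1] at e1
    rw [s2] at e2
    have := integral_add (i1 k) (i2 k)
    simp only [F]
    rw [this]
    linarith
  obtain ⟨g, hg⟩ := exists_le_integral (integrable_finsetSum Finset.univ fun k _ ↦ hF k)
  have hsum : ∑ k, F k g < 1 := by
    refine hg.trans_lt (lt_of_le_of_lt ?_ hm)
    rw [integral_finsetSum _ fun k _ ↦ hF k]
    refine (Finset.sum_le_sum fun k _ ↦ hFint k).trans_eq ?_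
    simp only [Finset.sum_const, Finset.card_univ, nsmul_eq_mul]
    ring
  refine ⟨g, fun k ↦ ?_⟩
  have hk : F k g < 1 := lt_of_le_of_lt
    (Finset.single_le_sum (f := fun k ↦ F k g) (fun j _ ↦ by positivity) (Finset.mem_univ k)) hsum
  simp only [F, ← Real.exp_add] at hk
  have p1 := Real.exp_pos (-(ε / 8 * ((1 + ε) * m)) + ε / 8 * S k g)
  have p2 := Real.exp_pos (ε / 8 * ((1 - ε) * m) + -(ε / 8) * S k g)
  have l1 := Real.exp_lt_one_iff.1 (show
    Real.exp (-(ε / 8 * ((1 + ε) * m)) + ε / 8 * S k g) < 1 by linarith)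
  have l2 := Real.exp_lt_one_iff.1 (show
    Real.exp (ε / 8 * ((1 - ε) * m) + -(ε / 8) * S k g) < 1 by linarith)
  constructor
  · exact le_of_mul_le_mul_left (a := ε / 8) (by simp only [S] at l2; linarith) (by linarith)
  · exact le_of_mul_le_mul_left (a := ε / 8) (by simp only [S] at l1; linarith) (by linarith)

end GaussianSquare

/-- The **Johnson–Lindenstrauss lemma**: a linear map to `ℝ^m` that nearly preserves the norms of
finitely many given vectors. -/
lemma exists_linearMap_norm_sq_near {E : Type*} [NormedAddCommGroup E] [InnerProductSpace ℝ E]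
    [FiniteDimensional ℝ E] {ι : Type*} [Fintype ι] [Nonempty ι] (x : ι → E)
    {ε : ℝ} (hε : 0 < ε) (hε1 : ε ≤ 1) (m : ℕ)
    (hm : 2 * Fintype.card ι * Real.exp (-(m * ε ^ 2 / 16)) < 1) :
    ∃ A : E →ₗ[ℝ] EuclideanSpace ℝ (Fin m), ∀ k,
      (1 - ε) * ‖x k‖ ^ 2 ≤ ‖A (x k)‖ ^ 2 ∧ ‖A (x k)‖ ^ 2 ≤ (1 + ε) * ‖x k‖ ^ 2 := by
  classical
  let _ : MeasurableSpace E := borel E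
  have : BorelSpace E := ⟨rfl⟩
  have hm0 : 0 < (m : ℝ) := by
    rcases Nat.eq_zero_or_pos m with rfl | h
    · have : (1 : ℝ) ≤ Fintype.card ι := by exact_mod_cast Fintype.card_pos
      norm_num at hm
      linarith
    · exact_mod_cast h
  have hcard : (Fintype.card {k // x k ≠ 0} : ℝ) ≤ Fintype.card ι := by
    exact_mod_cast Fintype.card_subtype_le _
  obtain ⟨g, hg⟩ := exists_sum_inner_sq_near (fun k : {k // x k ≠ 0} ↦ ‖x k‖⁻¹ • x k)
    (fun k ↦ norm_smul_inv_norm k.2) hε hε1 m (lt_of_le_of_lt (by gcongr) hm)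
  let A : E →ₗ[ℝ] EuclideanSpace ℝ (Fin m) := (√m)⁻¹ •
    ((WithLp.linearEquiv 2 ℝ (Fin m → ℝ)).symm.toLinearMap ∘ₗ
      LinearMap.pi fun i ↦ (innerSL ℝ (g i)).toLinearMap)
  have hA : ∀ y, m * ‖A y‖ ^ 2 = ∑ i, inner ℝ y (g i) ^ 2 := by
    intro y
    rw [EuclideanSpace.real_norm_sq_eq, Finset.mul_sum]
    refine Finset.sum_congr rfl fun i _ ↦ ?_
    have : A y i = (√m)⁻¹ * inner ℝ (g i) y := by simp [A]
    rw [this, mul_pow, inv_pow, Real.sq_sqrt hm0.le, real_inner_comm]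
    field_simp
  refine ⟨A, fun k ↦ ?_⟩
  by_cases hk : x k = 0
  · simp [hk]
  have hn : 0 < ‖x k‖ ^ 2 := by positivity
  obtain ⟨h1, h2⟩ := hg ⟨k, hk⟩
  simp only [real_inner_smul_left, mul_pow, ← Finset.mul_sum, ← hA, inv_pow] at h1 h2
  rw [inv_mul_eq_div] at h1 h2
  rw [le_div_iff₀ hn] at h1
  rw [div_le_iff₀ hn] at h2
  constructor
  · exact le_of_mul_le_mul_left (by linarith) hm0
  · exact le_of_mul_le_mul_left (by linarith) hm0

/-- Johnson–Lindenstrauss dimension reduction for robust distance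
embeddings: there is a universal constant `C > 0` such that any `δ`-robust distance
embedding of a directed graph on `n ≥ 2` vertices (with `0 < δ ≤ 1`) can be replaced by a
`(δ/2)`-robust distance embedding into `ℝ^m` with `m ≤ ⌈C·(log n)/δ²⌉`. -/
theorem robust_embedding_dimension_reduction :
    ∃ C : ℝ, 0 < C ∧
      ∀ (V : Type) [Fintype V] (E : V → V → Prop), 2 ≤ Fintype.card V →
      ∀ δ : ℝ, 0 < δ → δ ≤ 1 →
      ∀ (d : ℕ) (φin φout : V → EuclideanSpace ℝ (Fin d)) (t : ℝ),
        (0 ≤ t ∧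
         (∀ u v, E u v ↔ ‖φout u - φin v‖ ≤ t) ∧
         (∀ u v, E u v → ‖φout u - φin v‖ ^ 2 ≤ t ^ 2) ∧
         (∀ u v, ¬ E u v → t ^ 2 * (1 + δ) ≤ ‖φout u - φin v‖ ^ 2)) →
      ∃ m : ℕ, m ≤ ⌈C * Real.log (Fintype.card V) / δ ^ 2⌉₊ ∧
        ∃ (ψin ψout : V → EuclideanSpace ℝ (Fin m)) (s : ℝ),
          0 ≤ s ∧
          (∀ u v, E u v ↔ ‖ψout u - ψin v‖ ≤ s) ∧
          (∀ u v, E u v → ‖ψout u - ψin v‖ ^ 2 ≤ s ^ 2) ∧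
          (∀ u v, ¬ E u v → s ^ 2 * (1 + δ / 2) ≤ ‖ψout u - ψin v‖ ^ 2) := by
  refine ⟨4096, by norm_num, ?_⟩
  intro V _ E hV δ hδ hδ1 d φin φout t ⟨ht, hE, _, hnot⟩
  set n : ℝ := (Fintype.card V : ℝ)
  set m := ⌈4096 * Real.log n / δ ^ 2⌉₊
  have hn : (2 : ℝ) ≤ n := Nat.ofNat_le_cast.2 hV
  have hne : Nonempty V := Fintype.card_pos_iff.1 (by omega)
  have hlog : 0 < Real.log n := Real.log_pos (by linarith)
  have hm : 4096 * Real.log n ≤ m * δ ^ 2 :=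
    (div_le_iff₀ (by positivity)).1 (Nat.le_ceil _)
  have hfail : 2 * Fintype.card (V × V) * Real.exp (-(m * (δ / 8) ^ 2 / 16)) < 1 := by
    rw [Fintype.card_prod, Nat.cast_mul]
    have hexp : Real.exp (-(m * (δ / 8) ^ 2 / 16)) ≤ (n ^ 4)⁻¹ := by
      rw [← Real.exp_log (show 0 < (n ^ 4)⁻¹ by positivity), Real.log_inv, Real.log_pow]
      apply Real.exp_le_exp.2
      push_cast
      linarith
    refine (mul_le_mul_of_nonneg_left hexp (by positivity)).trans_lt ?_
    change 2 * (n * n) * (n ^ 4)⁻¹ < 1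
    rw [← div_eq_mul_inv, div_lt_one (by positivity)]
    have hsq : 4 ≤ n * n := by nlinarith
    nlinarith
  obtain ⟨A, hA⟩ := exists_linearMap_norm_sq_near
    (fun p : V × V ↦ φout p.1 - φin p.2) (ε := δ / 8) (by linarith) (by linarith) m hfail
  have hs : √((1 + δ / 8) * t ^ 2) ^ 2 = (1 + δ / 8) * t ^ 2 := Real.sq_sqrt (by positivity)
  have hedge : ∀ u v, E u v →
      ‖A (φout u) - A (φin v)‖ ^ 2 ≤ √((1 + δ / 8) * t ^ 2) ^ 2 := by
    intro u v h
    rw [hs, ← map_sub]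
    refine (hA (u, v)).2.trans ?_
    have := (hE u v).1 h
    gcongr
  have hlower : ∀ u v, (1 - δ / 8) * ‖φout u - φin v‖ ^ 2 ≤ ‖A (φout u) - A (φin v)‖ ^ 2 := by
    intro u v
    rw [← map_sub]
    exact (hA (u, v)).1
  refine ⟨m, le_rfl, fun v ↦ A (φin v), fun u ↦ A (φout u), √((1 + δ / 8) * t ^ 2),
    Real.sqrt_nonneg _, ?_, hedge, ?_⟩
  · intro u v
    refine ⟨fun h ↦ (sq_le_sq₀ (norm_nonneg _) (Real.sqrt_nonneg _)).1 (hedge u v h), fun h ↦ ?_⟩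
    by_contra hc
    have h1 := (sq_le_sq₀ (norm_nonneg _) (Real.sqrt_nonneg _)).2 h
    have h2 := hlower u v
    have h3 := hnot u v hc
    have h4 : t ^ 2 < ‖φout u - φin v‖ ^ 2 :=
      (sq_lt_sq₀ ht (norm_nonneg _)).2 (not_le.1 (mt (hE u v).2 hc))
    rw [hs] at h1
    nlinarith [sq_nonneg t]
  · intro u v hc
    refine le_trans ?_ (hlower u v)
    rw [hs]
    refine le_trans ?_ (mul_le_mul_of_nonneg_left (hnot u v hc) (by linarith))
    have : (1 + δ / 8) * (1 + δ / 2) ≤ (1 - δ / 8) * (1 + δ) := by nlinarith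
    nlinarith [mul_le_mul_of_nonneg_right this (sq_nonneg t)]
end

section
/- Suppose a finite directed graph G = (V,E) has maps φ_in, φ_out : V → ℝ^d and per-vertex thresholds t_u ≥ 0 (u ∈ V) such that for all pairs of vertices u, v: (u,v) ∈ E ⇔ ‖φ_out(u) − φ_in(v)‖ ≤ t_u. Then G has a distance embedding (with a single uniform threshold) into ℝ^{d+1}. -/
theorem EuclideanSpace.norm_sq_cons_sub_cons {d : ℕ} (a b : ℝ)
    (x y : EuclideanSpace ℝ (Fin d)) :
    ‖WithLp.toLp 2 (Fin.cons a x.ofLp : Fin (d + 1) → ℝ) -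
        WithLp.toLp 2 (Fin.cons b y.ofLp : Fin (d + 1) → ℝ)‖ ^ 2 =
      (a - b) ^ 2 + ‖x - y‖ ^ 2 := by
  simp [EuclideanSpace.norm_sq_eq, Fin.sum_univ_succ]

/-- a "distance embedding" with per-vertex thresholds `t_u ≥ 0` in `ℝ^d` can
be converted into a distance embedding with a single uniform threshold in `ℝ^{d+1}`. -/
theorem varying_thresholds_to_uniform_threshold {V : Type*} [Fintype V]
    (E : V → V → Prop) {d : ℕ} (φin φout : V → EuclideanSpace ℝ (Fin d)) (t : V → ℝ)
    (ht : ∀ u, 0 ≤ t u)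
    (hemb : ∀ u v, E u v ↔ ‖φout u - φin v‖ ≤ t u) :
    ∃ (ψin ψout : V → EuclideanSpace ℝ (Fin (d + 1))) (s : ℝ),
      0 ≤ s ∧ ∀ u v, E u v ↔ ‖ψout u - ψin v‖ ≤ s := by
  have hs : 0 ≤ ∑ u, t u := Finset.sum_nonneg fun u _ => ht u
  refine ⟨fun v => WithLp.toLp 2 (Fin.cons 0 (φin v).ofLp),
    fun u => WithLp.toLp 2 (Fin.cons √((∑ w, t w) ^ 2 - t u ^ 2) (φout u).ofLp),
    ∑ u, t u, hs, fun u v => ?_⟩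
  have hle : t u ≤ ∑ w, t w := Finset.single_le_sum (fun w _ => ht w) (Finset.mem_univ u)
  have hsq : 0 ≤ (∑ w, t w) ^ 2 - t u ^ 2 := sub_nonneg.2 (pow_le_pow_left₀ (ht u) hle 2)
  rw [hemb, ← sq_le_sq₀ (norm_nonneg _) (ht u), ← sq_le_sq₀ (norm_nonneg _) hs,
    EuclideanSpace.norm_sq_cons_sub_cons, sub_zero, Real.sq_sqrt hsq]
  constructor <;> intro h <;> linarith
end
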